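/- arXiv:2102.09438 — 4 statements merged into one kernel-verified Lean document; each statement's English description precedes it below -/
import Mathlib

section
/- For every nondegenerate triangle in the Euclidean plane with vertices P₁, P₂, P₃ and sidelengths s₁ = |P₂P₃|, s₂ = |P₃P₁|, s₃ = |P₁P₂|, the power of the incenter with respect to the nine-point circle equals −(s₁³ + s₂³ + s₃³ − s₁²(s₂ + s₃) − s₂²(s₃ + s₁) − s₃²(s₁ + s₂) + 4s₁s₂s₃)/(4(s₁ + s₂ + s₃)). -/
open scoped RealInnerProductSpace

noncomputable section

/-- Points of the Euclidean plane. -/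
abbrev Pt := EuclideanSpace ℝ (Fin 2)

/-- The power of a point `X` with respect to the circle with center `C` and radius `ρ`. -/
def circlePower (X C : Pt) (ρ : ℝ) : ℝ := dist X C ^ 2 - ρ ^ 2

section NinePoint

variable {V : Type*} [NormedAddCommGroup V] [InnerProductSpace ℝ V]

/-- In an affinely spanning triple of points, a vector orthogonal to two sides vanishes. -/
theorem eq_zero_of_inner_sides_eq_zero {P₁ P₂ P₃ u : V}
    (hspan : affineSpan ℝ (Set.range ![P₁, P₂, P₃]) = ⊤)
    (h₂ : ⟪u, P₃ - P₁⟫ = 0) (h₃ : ⟪u, P₁ - P₂⟫ = 0) : u = 0 := by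
  have hv : vectorSpan ℝ (Set.range ![P₁, P₂, P₃]) = ⊤ := by
    rw [← direction_affineSpan, hspan, AffineSubspace.direction_top]
  rw [vectorSpan_range_eq_span_range_vsub_right ℝ _ 0] at hv
  have hle : (⊤ : Submodule ℝ V) ≤ (ℝ ∙ u)ᗮ := by
    rw [← hv, Submodule.span_le]
    rintro _ ⟨i, rfl⟩
    rw [SetLike.mem_coe, Submodule.mem_orthogonal_singleton_iff_inner_right]
    fin_cases i
    · simp
    · simpa [inner_sub_right, sub_eq_zero, eq_comm] using h₃
    · simpa using h₂
  have hu : u ∈ (ℝ ∙ u)ᗮ := hle Submodule.mem_top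
  rwa [Submodule.mem_orthogonal_singleton_iff_inner_right, inner_self_eq_zero] at hu

/-- If `O` is equidistant from `B` and `C` and `H` lies on the altitude from `A`, then
`H - (A + B + C - 2 O)` is orthogonal to `B - C`. -/
theorem inner_sub_circumcenter_sum_eq_zero {A B C O H : V} (hO : dist O B = dist O C)
    (hH : ⟪H - A, B - C⟫ = 0) : ⟪H - (A + B + C - (2 : ℝ) • O), B - C⟫ = 0 := by
  have hO' : ‖B - O‖ = ‖C - O‖ := by simpa only [dist_comm O, dist_eq_norm] using hO
  have hsum : ⟪(B - O) + (C - O), (B - O) - (C - O)⟫ = 0 :=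
    (real_inner_add_sub_eq_zero_iff _ _).2 hO'
  have hvec : H - (A + B + C - (2 : ℝ) • O) = (H - A) - ((B - O) + (C - O)) := by module
  rw [hvec, inner_sub_left, hH, ← sub_sub_sub_cancel_right B C O, hsum, sub_zero]

/-- The inner product of two radii of a circle in terms of the chord they cut off. -/
theorem inner_eq_of_norm_eq_of_norm_sub {a b : V} {R s : ℝ} (ha : ‖a‖ = R) (hb : ‖b‖ = R)
    (hs : ‖a - b‖ = s) : ⟪a, b⟫ = R ^ 2 - s ^ 2 / 2 := by
  have h := norm_sub_sq_real a b
  rw [ha, hb, hs] at h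
  linarith

/-- The squared norm of a linear combination of three radii of a circle in terms of the chords. -/
theorem norm_sq_smul_add_smul_add_smul {a b c : V} {R s₁ s₂ s₃ : ℝ}
    (ha : ‖a‖ = R) (hb : ‖b‖ = R) (hc : ‖c‖ = R)
    (h₁ : ‖b - c‖ = s₁) (h₂ : ‖c - a‖ = s₂) (h₃ : ‖a - b‖ = s₃) (x y z : ℝ) :
    ‖x • a + y • b + z • c‖ ^ 2 =
      R ^ 2 * (x + y + z) ^ 2 - y * z * s₁ ^ 2 - z * x * s₂ ^ 2 - x * y * s₃ ^ 2 := by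
  rw [norm_add_sq_real, norm_add_sq_real]
  simp only [norm_smul, mul_pow, Real.norm_eq_abs, sq_abs, inner_add_left, real_inner_smul_left,
    real_inner_smul_right, ha, hb, hc, real_inner_comm c a,
    inner_eq_of_norm_eq_of_norm_sub ha hb h₃, inner_eq_of_norm_eq_of_norm_sub hb hc h₁,
    inner_eq_of_norm_eq_of_norm_sub hc ha h₂]
  ring

end NinePoint

/-- the power of the incenter with respect to the nine-point circle
equals `−(s₁³ + s₂³ + s₃³ − s₁²(s₂ + s₃) − s₂²(s₃ + s₁) − s₃²(s₁ + s₂) + 4s₁s₂s₃)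
/ (4(s₁ + s₂ + s₃))`. -/
theorem power_incenter_ninepoint
    (P₁ P₂ P₃ : Pt)
    (hnd : AffineIndependent ℝ ![P₁, P₂, P₃])
    (s₁ s₂ s₃ : ℝ)
    (hs₁ : s₁ = dist P₂ P₃) (hs₂ : s₂ = dist P₃ P₁) (hs₃ : s₃ = dist P₁ P₂)
    (I : Pt)
    (hI : I = (s₁ + s₂ + s₃)⁻¹ • (s₁ • P₁ + s₂ • P₂ + s₃ • P₃))
    (O : Pt) (R : ℝ)
    (hO₁ : dist O P₁ = R) (hO₂ : dist O P₂ = R) (hO₃ : dist O P₃ = R)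
    (H : Pt)
    (hH₁ : ⟪H - P₁, P₂ - P₃⟫ = 0)
    (hH₂ : ⟪H - P₂, P₃ - P₁⟫ = 0)
    (hH₃ : ⟪H - P₃, P₁ - P₂⟫ = 0) :
    circlePower I (midpoint ℝ O H) (R / 2) =
      -(s₁ ^ 3 + s₂ ^ 3 + s₃ ^ 3 - s₁ ^ 2 * (s₂ + s₃) - s₂ ^ 2 * (s₃ + s₁)
        - s₃ ^ 2 * (s₁ + s₂) + 4 * s₁ * s₂ * s₃) / (4 * (s₁ + s₂ + s₃)) := by
  have hspan : affineSpan ℝ (Set.range ![P₁, P₂, P₃]) = ⊤ :=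
    hnd.affineSpan_eq_top_iff_card_eq_finrank_add_one.2 (by simp)
  have hH : H = P₁ + P₂ + P₃ - (2 : ℝ) • O := by
    refine sub_eq_zero.1 (eq_zero_of_inner_sides_eq_zero hspan ?_ ?_)
    · rw [show P₁ + P₂ + P₃ = P₂ + P₃ + P₁ by abel]
      exact inner_sub_circumcenter_sum_eq_zero (hO₃.trans hO₁.symm) hH₂
    · rw [show P₁ + P₂ + P₃ = P₃ + P₁ + P₂ by abel]
      exact inner_sub_circumcenter_sum_eq_zero (hO₁.trans hO₂.symm) hH₃
  have hs₃_pos : 0 < s₃ := by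
    rw [hs₃, dist_pos]
    exact hnd.injective.ne (show (0 : Fin 3) ≠ 1 by decide)
  have hp : s₁ + s₂ + s₃ ≠ 0 := by
    have h₁ : 0 ≤ s₁ := hs₁ ▸ dist_nonneg
    have h₂ : 0 ≤ s₂ := hs₂ ▸ dist_nonneg
    positivity
  have hIN : I - midpoint ℝ O H = (s₁ / (s₁ + s₂ + s₃) - 1 / 2) • (P₁ - O)
      + (s₂ / (s₁ + s₂ + s₃) - 1 / 2) • (P₂ - O) + (s₃ / (s₁ + s₂ + s₃) - 1 / 2) • (P₃ - O) := by
    rw [hI, hH, midpoint_eq_smul_add, invOf_eq_inv]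
    match_scalars <;> field_simp
    ring
  rw [dist_comm, dist_eq_norm] at hO₁ hO₂ hO₃
  rw [dist_eq_norm] at hs₁ hs₂ hs₃
  rw [circlePower, dist_eq_norm, hIN, norm_sq_smul_add_smul_add_smul hO₁ hO₂ hO₃
    (s₁ := s₁) (s₂ := s₂) (s₃ := s₃) (by rw [hs₁, sub_sub_sub_cancel_right])
    (by rw [hs₂, sub_sub_sub_cancel_right]) (by rw [hs₃, sub_sub_sub_cancel_right])]
  field_simp
  ring
end
end

section
/- For every nondegenerate triangle in the Euclidean plane with vertices P₁, P₂, P₃ and sidelengths s₁ = |P₂P₃|, s₂ = |P₃P₁|, s₃ = |P₁P₂|, the power of the Mittenpunkt X₉ with respect to the circumcircle equals −(s₁³ + s₂³ + s₃³ − s₁²(s₂ + s₃) − s₂²(s₃ + s₁) − s₃²(s₂ + s₁) + 6s₁s₂s₃)·s₁s₂s₃/(s₁² + s₂² + s₃² − 2s₁s₂ − 2s₂s₃ − 2s₃s₁)². -/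
open scoped RealInnerProductSpace

noncomputable section

/-- The power of a weighted mean of three points of a circle. -/
theorem circlePower_weighted_mean {P₁ P₂ P₃ O : Pt} {R w₁ w₂ w₃ : ℝ}
    (hW : w₁ + w₂ + w₃ ≠ 0)
    (hO₁ : dist O P₁ = R) (hO₂ : dist O P₂ = R) (hO₃ : dist O P₃ = R) :
    circlePower ((w₁ + w₂ + w₃)⁻¹ • (w₁ • P₁ + w₂ • P₂ + w₃ • P₃)) O R =
      -(w₂ * w₃ * dist P₂ P₃ ^ 2 + w₃ * w₁ * dist P₃ P₁ ^ 2 + w₁ * w₂ * dist P₁ P₂ ^ 2)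
        / (w₁ + w₂ + w₃) ^ 2 := by
  have sq_dist (x y : Pt) : dist x y ^ 2 = (x 0 - y 0) ^ 2 + (x 1 - y 1) ^ 2 := by
    rw [EuclideanSpace.dist_eq, Real.sq_sqrt (by positivity)]
    simp [Fin.sum_univ_two, Real.dist_eq, sq_abs]
  have h₁ : dist O P₁ ^ 2 = R ^ 2 := by rw [hO₁]
  have h₂ : dist O P₂ ^ 2 = R ^ 2 := by rw [hO₂]
  have h₃ : dist O P₃ ^ 2 = R ^ 2 := by rw [hO₃]
  simp only [circlePower, sq_dist, PiLp.smul_apply, PiLp.add_apply, smul_eq_mul] at *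
  field_simp
  linear_combination (w₁ + w₂ + w₃) * (w₁ * h₁ + w₂ * h₂ + w₃ * h₃)

/-- The weights of the Mittenpunkt have positive sum when the triangle inequalities hold. -/
theorem mittenpunkt_weights_sum_pos {a b c : ℝ} (ha : 0 < a) (hb : 0 < b) (hc : 0 < c)
    (hab : c ≤ a + b) (hbc : a ≤ b + c) (hca : b ≤ c + a) :
    0 < a * (b + c - a) + b * (c + a - b) + c * (a + b - c) := by
  have hA : 0 ≤ a * (b + c - a) := mul_nonneg ha.le (by linarith)
  have hB : 0 ≤ b * (c + a - b) := mul_nonneg hb.le (by linarith)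
  have hC : 0 ≤ c * (a + b - c) := mul_nonneg hc.le (by linarith)
  rcases hbc.lt_or_eq with h | h
  · have : 0 < a * (b + c - a) := mul_pos ha (by linarith)
    linarith
  · have : 0 < b * (c + a - b) := mul_pos hb (by linarith)
    linarith

/-- the power of the Mittenpunkt `X₉` with respect to the circumcircle
equals `−(s₁³ + s₂³ + s₃³ − s₁²(s₂ + s₃) − s₂²(s₃ + s₁) − s₃²(s₂ + s₁) + 6s₁s₂s₃)·s₁s₂s₃
/ (s₁² + s₂² + s₃² − 2s₁s₂ − 2s₂s₃ − 2s₃s₁)²`. -/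
theorem power_mittenpunkt_circumcircle
    (P₁ P₂ P₃ : Pt)
    (hnd : AffineIndependent ℝ ![P₁, P₂, P₃])
    (s₁ s₂ s₃ : ℝ)
    (hs₁ : s₁ = dist P₂ P₃) (hs₂ : s₂ = dist P₃ P₁) (hs₃ : s₃ = dist P₁ P₂)
    (w₁ w₂ w₃ : ℝ)
    (hw₁ : w₁ = s₁ * (s₂ + s₃ - s₁)) (hw₂ : w₂ = s₂ * (s₃ + s₁ - s₂))
    (hw₃ : w₃ = s₃ * (s₁ + s₂ - s₃))
    (X₉ : Pt)
    (hX₉ : X₉ = (w₁ + w₂ + w₃)⁻¹ • (w₁ • P₁ + w₂ • P₂ + w₃ • P₃))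
    (O : Pt) (R : ℝ)
    (hO₁ : dist O P₁ = R) (hO₂ : dist O P₂ = R) (hO₃ : dist O P₃ = R) :
    circlePower X₉ O R =
      -(s₁ ^ 3 + s₂ ^ 3 + s₃ ^ 3 - s₁ ^ 2 * (s₂ + s₃) - s₂ ^ 2 * (s₃ + s₁)
          - s₃ ^ 2 * (s₂ + s₁) + 6 * s₁ * s₂ * s₃) * (s₁ * s₂ * s₃)
        / (s₁ ^ 2 + s₂ ^ 2 + s₃ ^ 2 - 2 * s₁ * s₂ - 2 * s₂ * s₃ - 2 * s₃ * s₁) ^ 2 := by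
  have hs₁_pos : 0 < s₁ := hs₁ ▸ dist_pos.2 (by simpa using hnd.injective.ne (a₁ := 1) (a₂ := 2))
  have hs₂_pos : 0 < s₂ := hs₂ ▸ dist_pos.2 (by simpa using hnd.injective.ne (a₁ := 2) (a₂ := 0))
  have hs₃_pos : 0 < s₃ := hs₃ ▸ dist_pos.2 (by simpa using hnd.injective.ne (a₁ := 0) (a₂ := 1))
  have hW : 0 < w₁ + w₂ + w₃ := by
    rw [hw₁, hw₂, hw₃]
    refine mittenpunkt_weights_sum_pos hs₁_pos hs₂_pos hs₃_pos ?_ ?_ ?_ <;> rw [hs₁, hs₂, hs₃]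
    · linarith [dist_triangle_left P₁ P₂ P₃, dist_comm P₂ P₃]
    · linarith [dist_triangle_left P₂ P₃ P₁, dist_comm P₃ P₁]
    · linarith [dist_triangle_left P₃ P₁ P₂, dist_comm P₁ P₂]
  have hsum : (s₁ ^ 2 + s₂ ^ 2 + s₃ ^ 2 - 2 * s₁ * s₂ - 2 * s₂ * s₃ - 2 * s₃ * s₁) ^ 2
      = (w₁ + w₂ + w₃) ^ 2 := by
    rw [hw₁, hw₂, hw₃]
    ring
  rw [hX₉, circlePower_weighted_mean hW.ne' hO₁ hO₂ hO₃, ← hs₁, ← hs₂, ← hs₃, hsum]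
  congr 1
  rw [hw₁, hw₂, hw₃]
  ring
end
end

section
/- For every nondegenerate triangle in the Euclidean plane with vertices P₁, P₂, P₃ and sidelengths s₁ = |P₂P₃|, s₂ = |P₃P₁|, s₃ = |P₁P₂|, the power of the Mittenpunkt X₉ with respect to the Bevan circle of the triangle equals −12·(s₁s₂s₃)²/(s₁² + s₂² + s₃² − 2s₁s₂ − 2s₂s₃ − 2s₃s₁)². -/
open scoped RealInnerProductSpace

noncomputable section

/-- The squared norm of a linear combination of three vectors in terms of their norms and
mutual distances. -/
theorem norm_sq_linear_combination_three {E : Type*} [NormedAddCommGroup E]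
    [InnerProductSpace ℝ E] (a b c : ℝ) (u v w : E) :
    ‖a • u + b • v + c • w‖ ^ 2 =
      (a + b + c) * (a * ‖u‖ ^ 2 + b * ‖v‖ ^ 2 + c * ‖w‖ ^ 2)
        - (b * c * ‖v - w‖ ^ 2 + c * a * ‖w - u‖ ^ 2 + a * b * ‖u - v‖ ^ 2) := by
  simp only [← real_inner_self_eq_norm_sq, inner_add_left, inner_add_right, inner_sub_left,
    inner_sub_right, real_inner_smul_left, real_inner_smul_right, real_inner_comm u v,
    real_inner_comm u w, real_inner_comm v w]
  ring

/-- The sum of the Mittenpunkt weights of a triangle is positive. -/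
theorem mittenpunkt_weights_pos {a b c : ℝ} (ha : 0 < a) (hb : 0 < b) (hc : 0 < c)
    (h₁ : a ≤ b + c) (h₂ : b ≤ c + a) (h₃ : c ≤ a + b) :
    0 < a * (b + c - a) + b * (c + a - b) + c * (a + b - c) := by
  have k₁ := mul_nonneg ha.le (sub_nonneg.2 h₁)
  have k₂ := mul_nonneg hb.le (sub_nonneg.2 h₂)
  have k₃ := mul_nonneg hc.le (sub_nonneg.2 h₃)
  rcases h₁.lt_or_eq with h | h
  · have := mul_pos ha (sub_pos.2 h)
    linarith
  · have := mul_pos hb (show 0 < c + a - b by linarith)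
    linarith

/-- the power of the Mittenpunkt `X₉` with respect to the Bevan circle
(center `2O − I`, radius `2R`) equals
`−12·(s₁s₂s₃)²/(s₁² + s₂² + s₃² − 2s₁s₂ − 2s₂s₃ − 2s₃s₁)²`. -/
theorem power_mittenpunkt_bevan
    (P₁ P₂ P₃ : Pt)
    (hnd : AffineIndependent ℝ ![P₁, P₂, P₃])
    (s₁ s₂ s₃ : ℝ)
    (hs₁ : s₁ = dist P₂ P₃) (hs₂ : s₂ = dist P₃ P₁) (hs₃ : s₃ = dist P₁ P₂)
    (w₁ w₂ w₃ : ℝ)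
    (hw₁ : w₁ = s₁ * (s₂ + s₃ - s₁)) (hw₂ : w₂ = s₂ * (s₃ + s₁ - s₂))
    (hw₃ : w₃ = s₃ * (s₁ + s₂ - s₃))
    (X₉ : Pt)
    (hX₉ : X₉ = (w₁ + w₂ + w₃)⁻¹ • (w₁ • P₁ + w₂ • P₂ + w₃ • P₃))
    (I : Pt)
    (hI : I = (s₁ + s₂ + s₃)⁻¹ • (s₁ • P₁ + s₂ • P₂ + s₃ • P₃))
    (O : Pt) (R : ℝ)
    (hO₁ : dist O P₁ = R) (hO₂ : dist O P₂ = R) (hO₃ : dist O P₃ = R) :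
    circlePower X₉ ((2 : ℝ) • O - I) (2 * R) =
      -12 * (s₁ * s₂ * s₃) ^ 2
        / (s₁ ^ 2 + s₂ ^ 2 + s₃ ^ 2 - 2 * s₁ * s₂ - 2 * s₂ * s₃ - 2 * s₃ * s₁) ^ 2 := by
  have hinj := hnd.injective
  have h₁ : 0 < s₁ := hs₁ ▸ dist_pos.2 fun h => by simpa using @hinj 1 2 (by simpa using h)
  have h₂ : 0 < s₂ := hs₂ ▸ dist_pos.2 fun h => by simpa using @hinj 2 0 (by simpa using h)
  have h₃ : 0 < s₃ := hs₃ ▸ dist_pos.2 fun h => by simpa using @hinj 0 1 (by simpa using h)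
  have t₁ : s₁ ≤ s₂ + s₃ := by
    have := dist_triangle_left P₂ P₃ P₁
    rw [hs₁, hs₂, hs₃, dist_comm P₃ P₁]
    linarith
  have t₂ : s₂ ≤ s₃ + s₁ := by
    have := dist_triangle_left P₃ P₁ P₂
    rw [hs₁, hs₂, hs₃, dist_comm P₁ P₂]
    linarith
  have t₃ : s₃ ≤ s₁ + s₂ := by
    have := dist_triangle_left P₁ P₂ P₃
    rw [hs₁, hs₂, hs₃, dist_comm P₂ P₃]
    linarith
  have hσ : s₁ + s₂ + s₃ ≠ 0 := by positivity
  have hW : w₁ + w₂ + w₃ ≠ 0 := by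
    rw [hw₁, hw₂, hw₃]
    exact (mittenpunkt_weights_pos h₁ h₂ h₃ t₁ t₂ t₃).ne'
  set m₁ := w₁ / (w₁ + w₂ + w₃) + s₁ / (s₁ + s₂ + s₃) with hm₁
  set m₂ := w₂ / (w₁ + w₂ + w₃) + s₂ / (s₁ + s₂ + s₃) with hm₂
  set m₃ := w₃ / (w₁ + w₂ + w₃) + s₃ / (s₁ + s₂ + s₃) with hm₃
  have hm : m₁ + m₂ + m₃ = 2 := by
    rw [hm₁, hm₂, hm₃]
    field_simp
    ring
  have hvec : X₉ - ((2 : ℝ) • O - I) = m₁ • (P₁ - O) + m₂ • (P₂ - O) + m₃ • (P₃ - O) := by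
    have hO : (2 : ℝ) • O = (m₁ + m₂ + m₃) • O := by rw [hm]
    rw [hO, hX₉, hI, hm₁, hm₂, hm₃]
    module
  rw [circlePower, dist_eq_norm, hvec, norm_sq_linear_combination_three, hm,
    sub_sub_sub_cancel_right, sub_sub_sub_cancel_right, sub_sub_sub_cancel_right]
  simp only [← dist_eq_norm, ← hs₁, ← hs₂, ← hs₃, dist_comm _ O, hO₁, hO₂, hO₃]
  have hQ : s₁ ^ 2 + s₂ ^ 2 + s₃ ^ 2 - 2 * s₁ * s₂ - 2 * s₂ * s₃ - 2 * s₃ * s₁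
      = -(w₁ + w₂ + w₃) := by
    rw [hw₁, hw₂, hw₃]
    ring
  have hR : 2 * (m₁ * R ^ 2 + m₂ * R ^ 2 + m₃ * R ^ 2) = (2 * R) ^ 2 := by
    linear_combination 2 * R ^ 2 * hm
  have key : m₂ * m₃ * s₁ ^ 2 + m₃ * m₁ * s₂ ^ 2 + m₁ * m₂ * s₃ ^ 2
      = 12 * (s₁ * s₂ * s₃) ^ 2 / (w₁ + w₂ + w₃) ^ 2 := by
    rw [hm₁, hm₂, hm₃]
    field_simp
    rw [hw₁, hw₂, hw₃]
    ring
  rw [hQ, hR, key]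
  ring
end
end

section
/- Let p, q ∈ ℝ with p > q ≥ 0 (so p ≠ ±q), let z₁, z₂, z₃ be distinct points on the unit circle in ℂ, and set v_i = p·z_i + q·conj(z_i) for i = 1, 2, 3; assume v₁, v₂, v₃ are affinely independent over ℝ. Write σ₁ = z₁ + z₂ + z₃, σ₂ = z₁z₂ + z₂z₃ + z₃z₁, σ₃ = z₁z₂z₃. Let X₂ = (v₁ + v₂ + v₃)/3 be the barycenter and X₃ the circumcenter of the triangle v₁v₂v₃. Then for any α, β ∈ ℂ: α·X₂ + β·X₃ = (p²q(σ₂(α + 3β) + 3β·σ₃²) + α·p³·σ₁σ₃ − pq²(3β + σ₁σ₃(α + 3β)) − α·q³·σ₂)/(3·σ₃·(p − q)(p + q)). -/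
open Complex

noncomputable section

/-- If a palindromic-ended quartic `k z⁴ - V z³ - c z² - W z + k` has three distinct roots, then
`V` and `W` are determined by `k` and the elementary symmetric polynomials of these roots. -/
theorem quartic_coeffs_of_three_roots {K : Type*} [Field K] {k V W c a b d : K}
    (hab : a ≠ b) (hbd : b ≠ d) (had : a ≠ d)
    (ha : k * (a ^ 4 + 1) - V * a ^ 3 - W * a - c * a ^ 2 = 0)
    (hb : k * (b ^ 4 + 1) - V * b ^ 3 - W * b - c * b ^ 2 = 0)
    (hd : k * (d ^ 4 + 1) - V * d ^ 3 - W * d - c * d ^ 2 = 0) :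
    a * b * d * V = k * ((a + b + d) * (a * b * d) + 1) ∧
      a * b * d * W = k * (a * b + b * d + d * a + (a * b * d) ^ 2) := by
  have h₁ : k * (a ^ 3 + a ^ 2 * b + a * b ^ 2 + b ^ 3) - V * (a ^ 2 + a * b + b ^ 2) - W
      - c * (a + b) = 0 :=
    mul_left_cancel₀ (sub_ne_zero.2 hab) (by linear_combination ha - hb)
  have h₂ : k * (b ^ 3 + b ^ 2 * d + b * d ^ 2 + d ^ 3) - V * (b ^ 2 + b * d + d ^ 2) - W
      - c * (b + d) = 0 :=
    mul_left_cancel₀ (sub_ne_zero.2 hbd) (by linear_combination hb - hd)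
  have h₃ : k * (a ^ 2 + b ^ 2 + d ^ 2 + a * b + b * d + d * a) - V * (a + b + d) - c = 0 :=
    mul_left_cancel₀ (sub_ne_zero.2 had) (by linear_combination h₁ - h₂)
  have hV : a * b * d * V = k * ((a + b + d) * (a * b * d) + 1) := by
    linear_combination -(ha - a * h₁ + a * b * h₃)
  refine ⟨hV, ?_⟩
  linear_combination (a * b + b * d + d * a) * hV - a * b * d * (h₁ - (a + b) * h₃)

/-- Squared distance from `X` to a point `p z + q z̄` of an ellipse, `z` on the unit circle. -/
theorem sq_mul_dist_sq_ellipse_point (p q : ℝ) {z : ℂ} (hz : ‖z‖ = 1) (X : ℂ) :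
    z ^ 2 * (dist X (p * z + q * starRingEnd ℂ z) : ℂ) ^ 2 =
      p * q * (z ^ 4 + 1) - (p * starRingEnd ℂ X + q * X) * z ^ 3
        - (p * X + q * starRingEnd ℂ X) * z
        + (X * starRingEnd ℂ X + p ^ 2 + q ^ 2) * z ^ 2 := by
  have hzz : z * starRingEnd ℂ z = 1 := by simp [Complex.mul_conj', hz]
  rw [Complex.dist_eq, ← Complex.mul_conj']
  simp only [map_sub, map_add, map_mul, Complex.conj_ofReal, Complex.conj_conj]
  generalize starRingEnd ℂ z = u at *
  generalize starRingEnd ℂ X = Y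
  linear_combination (p * q * (z * u + 1) + z ^ 2 * (p ^ 2 + q ^ 2) - p * X * z
    - q * Y * z) * hzz

/-- for a triangle inscribed in the ellipse with semi-axes `p + q`,
`p − q` (image of a triangle `z₁z₂z₃` inscribed in the unit circle under
`z ↦ p·z + q·conj z`), any fixed linear combination `α·X₂ + β·X₃` of barycenter and
circumcenter has the stated explicit expression in the elementary symmetric
polynomials `σ₁, σ₂, σ₃` of `z₁, z₂, z₃`. -/
theorem affine_combination_barycenter_circumcenter_formula
    (p q : ℝ) (hpq : p > q) (hq : q ≥ 0)
    (z₁ z₂ z₃ : ℂ)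
    (hz₁ : ‖z₁‖ = 1) (hz₂ : ‖z₂‖ = 1) (hz₃ : ‖z₃‖ = 1)
    (h12 : z₁ ≠ z₂) (h23 : z₂ ≠ z₃) (h13 : z₁ ≠ z₃)
    (v₁ v₂ v₃ : ℂ)
    (hv₁ : v₁ = (p : ℂ) * z₁ + (q : ℂ) * (starRingEnd ℂ) z₁)
    (hv₂ : v₂ = (p : ℂ) * z₂ + (q : ℂ) * (starRingEnd ℂ) z₂)
    (hv₃ : v₃ = (p : ℂ) * z₃ + (q : ℂ) * (starRingEnd ℂ) z₃)
    (hnd : AffineIndependent ℝ ![v₁, v₂, v₃])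
    (σ₁ σ₂ σ₃ : ℂ)
    (hσ₁ : σ₁ = z₁ + z₂ + z₃) (hσ₂ : σ₂ = z₁ * z₂ + z₂ * z₃ + z₃ * z₁)
    (hσ₃ : σ₃ = z₁ * z₂ * z₃)
    -- barycenter
    (X₂ : ℂ) (hX₂ : X₂ = (v₁ + v₂ + v₃) / 3)
    -- circumcenter: the point equidistant from the three vertices
    (X₃ : ℂ) (hX₃₁ : dist X₃ v₁ = dist X₃ v₂) (hX₃₂ : dist X₃ v₂ = dist X₃ v₃)
    (α β : ℂ) :
    α * X₂ + β * X₃ =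
      ((p : ℂ) ^ 2 * (q : ℂ) * (σ₂ * (α + 3 * β) + 3 * β * σ₃ ^ 2)
          + α * (p : ℂ) ^ 3 * σ₁ * σ₃
          - (p : ℂ) * (q : ℂ) ^ 2 * (3 * β + σ₁ * σ₃ * (α + 3 * β))
          - α * (q : ℂ) ^ 3 * σ₂)
        / (3 * σ₃ * ((p : ℂ) - (q : ℂ)) * ((p : ℂ) + (q : ℂ))) := by
  have hne : ∀ {z : ℂ}, ‖z‖ = 1 → z ≠ 0 := fun h => norm_ne_zero_iff.1 (by simp [h])
  have hconj : ∀ {z : ℂ}, ‖z‖ = 1 → starRingEnd ℂ z = z⁻¹ := fun h =>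
    (Complex.inv_eq_conj h).symm
  have e₁ := sq_mul_dist_sq_ellipse_point p q hz₁ X₃
  have e₂ := sq_mul_dist_sq_ellipse_point p q hz₂ X₃
  have e₃ := sq_mul_dist_sq_ellipse_point p q hz₃ X₃
  rw [← hv₁, hX₃₁, hX₃₂] at e₁
  rw [← hv₂, hX₃₂] at e₂
  rw [← hv₃] at e₃
  obtain ⟨hV, hW⟩ := quartic_coeffs_of_three_roots (k := (p : ℂ) * q)
    (V := p * starRingEnd ℂ X₃ + q * X₃) (W := p * X₃ + q * starRingEnd ℂ X₃)
    (c := (dist X₃ v₃ : ℂ) ^ 2 - (X₃ * starRingEnd ℂ X₃ + p ^ 2 + q ^ 2)) h12 h23 h13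
    (by linear_combination -e₁) (by linear_combination -e₂) (by linear_combination -e₃)
  rw [← hσ₁, ← hσ₃] at hV
  rw [← hσ₂, ← hσ₃] at hW
  have hσ₃0 : σ₃ ≠ 0 := by
    rw [hσ₃]
    exact mul_ne_zero (mul_ne_zero (hne hz₁) (hne hz₂)) (hne hz₃)
  have hX₂' : 3 * σ₃ * X₂ = p * σ₁ * σ₃ + q * σ₂ := by
    have := hne hz₁
    have := hne hz₂
    have := hne hz₃
    rw [hX₂, hv₁, hv₂, hv₃, hconj hz₁, hconj hz₂, hconj hz₃, hσ₁, hσ₂, hσ₃]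
    field_simp
    ring
  have hsub : (p : ℂ) - q ≠ 0 := by exact_mod_cast (sub_pos.2 hpq).ne'
  have hadd : (p : ℂ) + q ≠ 0 := by
    exact_mod_cast (add_pos_of_pos_of_nonneg (hq.trans_lt hpq) hq).ne'
  rw [eq_div_iff (by simp [hσ₃0, hsub, hadd])]
  linear_combination α * (p ^ 2 - q ^ 2) * hX₂' + 3 * β * (p * hW - q * hV)
end
end
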